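/- arXiv:2411.15932 — 2 statements merged into one kernel-verified Lean document; each statement's English description precedes it below -/
import Mathlib

section
/- For every real γ > 0, every real p ≥ 1, every r with 0 < r < 1, and every s with 0 ≤ s ≤ π r, the pointwise p-dilatation of the reflection Φ(r,s) = (r, S(r,s)) satisfies ‖DΦ(r,s)‖^p / |det DΦ(r,s)| ≤ C_γ · r^{−γ}, where C_γ = π ( 1 + (γ+1)² π⁴/(π−1)⁴ + 1/(π−1)² )^{p/2}. -/
open Real

/-- The natural reflection `Φ(r,s) = (r, r^γ (π r − s)/(π − r^γ))` of the exterior of the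
two-dimensional outward cuspidal domain with `γ`-cusp onto the cusp. -/
noncomputable def cuspReflection (γ : ℝ) :
    EuclideanSpace ℝ (Fin 2) → EuclideanSpace ℝ (Fin 2) := fun x =>
  (WithLp.equiv 2 (Fin 2 → ℝ)).symm
    ![x 0, x 0 ^ γ * (Real.pi * x 0 - x 1) / (Real.pi - x 0 ^ γ)]

/-- The operator norm of a real matrix on Euclidean space is at most its Frobenius norm. -/
theorem norm_toEuclideanCLM_le_sqrt_sum_sq {n : Type*} [Fintype n] [DecidableEq n]
    (A : Matrix n n ℝ) :
    ‖Matrix.toEuclideanCLM (n := n) (𝕜 := ℝ) A‖ ≤ √(∑ i, ∑ j, A i j ^ 2) := by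
  refine ContinuousLinearMap.opNorm_le_bound _ (Real.sqrt_nonneg _) fun x => ?_
  rw [EuclideanSpace.norm_eq, EuclideanSpace.norm_eq, ← Real.sqrt_mul (by positivity),
    Finset.sum_mul]
  refine Real.sqrt_le_sqrt (Finset.sum_le_sum fun i _ => ?_)
  simp only [Real.norm_eq_abs, sq_abs, Matrix.ofLp_toEuclideanCLM, Matrix.mulVec, dotProduct]
  exact Finset.sum_mul_sq_le_sq_mul_sq _ _ _

theorem det_toEuclideanCLM {n : Type*} [Fintype n] [DecidableEq n] (A : Matrix n n ℝ) :
    LinearMap.det (Matrix.toEuclideanCLM (n := n) (𝕜 := ℝ) A).toLinearMap = A.det := by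
  rw [Matrix.coe_toEuclideanCLM_eq_toEuclideanLin, Matrix.toEuclideanLin, Matrix.toLpLin_eq_toLin,
    LinearMap.det_toLin]

/-- The total derivative of the cusp reflection, as a Jacobian matrix. -/
theorem hasFDerivAt_cuspReflection {γ r s : ℝ} (hr : 0 < r) (hu : r ^ γ ≠ π) :
    HasFDerivAt (cuspReflection γ)
      (Matrix.toEuclideanCLM (n := Fin 2) (𝕜 := ℝ)
        !![1, 0;
          r ^ γ * π * (γ * (π * r - s) / r + (π - r ^ γ)) / (π - r ^ γ) ^ 2,
          -(r ^ γ / (π - r ^ γ))])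
      ((WithLp.equiv 2 (Fin 2 → ℝ)).symm ![r, s]) := by
  set x := (WithLp.equiv 2 (Fin 2 → ℝ)).symm ![r, s]
  have hx0 : x 0 = r := rfl
  have hx1 : x 1 = s := rfl
  have hd : π - r ^ γ ≠ 0 := sub_ne_zero.mpr hu.symm
  have h0 : HasFDerivAt (fun y : EuclideanSpace ℝ (Fin 2) => y 0)
      (EuclideanSpace.proj 0 : EuclideanSpace ℝ (Fin 2) →L[ℝ] ℝ) x :=
    (EuclideanSpace.proj 0 : EuclideanSpace ℝ (Fin 2) →L[ℝ] ℝ).hasFDerivAt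
  have h1 : HasFDerivAt (fun y : EuclideanSpace ℝ (Fin 2) => y 1)
      (EuclideanSpace.proj 1 : EuclideanSpace ℝ (Fin 2) →L[ℝ] ℝ) x :=
    (EuclideanSpace.proj 1 : EuclideanSpace ℝ (Fin 2) →L[ℝ] ℝ).hasFDerivAt
  have hpow := h0.rpow_const (p := γ) (Or.inl (hx0 ▸ hr.ne'))
  have hinv := (hasDerivAt_inv (x := π - x 0 ^ γ) (by rw [hx0]; exact hd)).comp_hasFDerivAt x
    (hpow.const_sub π)
  have hS := (hpow.fun_mul ((h0.const_mul π).fun_sub h1)).fun_mul hinv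
  rw [← hasFDerivWithinAt_univ, hasFDerivWithinAt_euclidean]
  intro i
  rw [hasFDerivWithinAt_univ]
  fin_cases i
  · refine h0.congr_fderiv ?_
    ext v
    simp [Matrix.ofLp_toEuclideanCLM, Matrix.mulVec, dotProduct, Fin.sum_univ_two]
  · refine hS.congr_fderiv ?_
    ext v
    simp [Matrix.ofLp_toEuclideanCLM, Matrix.mulVec, dotProduct, Fin.sum_univ_two, hx0, hx1,
      Real.rpow_sub_one hr.ne']
    field_simp
    ring

/-- For every real `γ > 0`, `p ≥ 1`, `0 < r < 1` and `0 ≤ s ≤ π r`, the pointwise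
`p`-dilatation of the reflection `Φ` satisfies
`‖DΦ(r,s)‖^p / |det DΦ(r,s)| ≤ C_γ · r^{−γ}` with
`C_γ = π (1 + (γ+1)² π⁴/(π−1)⁴ + 1/(π−1)²)^{p/2}`. -/
theorem cusp_reflection_dilatation_bound (γ p : ℝ) (hγ : 0 < γ) (hp : 1 ≤ p)
    (r s : ℝ) (hr0 : 0 < r) (hr1 : r < 1) (hs0 : 0 ≤ s) (hs1 : s ≤ Real.pi * r) :
    ‖fderiv ℝ (cuspReflection γ) ((WithLp.equiv 2 (Fin 2 → ℝ)).symm ![r, s])‖ ^ p /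
        |LinearMap.det
          (fderiv ℝ (cuspReflection γ)
            ((WithLp.equiv 2 (Fin 2 → ℝ)).symm ![r, s])).toLinearMap| ≤
      (Real.pi * (1 + (γ + 1) ^ 2 * Real.pi ^ 4 / (Real.pi - 1) ^ 4 +
        1 / (Real.pi - 1) ^ 2) ^ (p / 2)) * r ^ (-γ) := by
  have hπ : 1 < π := by linarith [Real.pi_gt_three]
  have hu0 : 0 < r ^ γ := Real.rpow_pos_of_pos hr0 γ
  have hu1 : r ^ γ < 1 := Real.rpow_lt_one hr0.le hr1 hγ
  rw [(hasFDerivAt_cuspReflection hr0 (by linarith)).fderiv, det_toEuclideanCLM,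
    Matrix.det_fin_two_of, Real.rpow_neg hr0.le]
  set u := r ^ γ
  set a := u * π * (γ * (π * r - s) / r + (π - u)) / (π - u) ^ 2 with ha
  set b := u / (π - u) with hb
  set C := 1 + (γ + 1) ^ 2 * π ^ 4 / (π - 1) ^ 4 + 1 / (π - 1) ^ 2
  have hd : 0 < π - 1 := by linarith
  have hdu : 0 < π - u := by linarith
  have hb0 : 0 < b := by positivity
  have hbound : b ≤ 1 / (π - 1) := by rw [hb]; gcongr
  have hq0 : 0 ≤ γ * (π * r - s) / r := by
    have : 0 ≤ π * r - s := by linarith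
    positivity
  have hq : γ * (π * r - s) / r ≤ γ * π := by
    rw [div_le_iff₀ hr0]
    nlinarith
  have ha0 : 0 ≤ a := by positivity
  have habound : a ≤ (γ + 1) * π ^ 2 / (π - 1) ^ 2 := by
    calc a ≤ 1 * π * (γ * π + π) / (π - 1) ^ 2 := by
          rw [ha]; gcongr; linarith
      _ = _ := by ring
  have hsq : 1 + a ^ 2 + b ^ 2 ≤ C := by
    have h1 : a ^ 2 ≤ ((γ + 1) * π ^ 2 / (π - 1) ^ 2) ^ 2 := by gcongr
    have h2 : b ^ 2 ≤ (1 / (π - 1)) ^ 2 := by gcongr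
    have h3 : ((γ + 1) * π ^ 2 / (π - 1) ^ 2) ^ 2 = (γ + 1) ^ 2 * π ^ 4 / (π - 1) ^ 4 := by
      rw [div_pow]; ring
    have h4 : (1 / (π - 1)) ^ 2 = 1 / (π - 1) ^ 2 := by rw [div_pow, one_pow]
    linarith
  have hC0 : 0 ≤ C := by positivity
  have hnorm : ‖Matrix.toEuclideanCLM (n := Fin 2) (𝕜 := ℝ) !![1, 0; a, -b]‖ ≤ √C := by
    refine (norm_toEuclideanCLM_le_sqrt_sum_sq _).trans (Real.sqrt_le_sqrt ?_)
    simpa [Fin.sum_univ_two, ← add_assoc] using hsq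
  have hdet : |1 * -b - 0 * a| = b := by
    simp [abs_of_pos hb0]
  have hinv : b⁻¹ ≤ π * u⁻¹ := by
    rw [hb, inv_div, div_eq_mul_inv]
    gcongr
    linarith
  have hpow : √C ^ p = C ^ (p / 2) := by
    rw [Real.sqrt_eq_rpow, ← Real.rpow_mul hC0]
    ring_nf
  calc _ ≤ √C ^ p * b⁻¹ := by
        rw [hdet, div_eq_mul_inv]; gcongr
    _ ≤ C ^ (p / 2) * (π * u⁻¹) := by rw [hpow]; gcongr
    _ = _ := by ring
end

section
/- Let n ≥ 2 and let α₁, …, αₙ be real numbers with −1 < α₁ ≤ α₂ ≤ ⋯ ≤ αₙ and α = α₁ + ⋯ + αₙ. Define φ : ℝⁿ → ℝⁿ by φ(x)ᵢ = xᵢ |x|^{αᵢ} for x ≠ 0 and φ(0) = 0. Then for every x ≠ 0 the Jacobian determinant of φ satisfies det Dφ(x) ≥ (1 + α₁) |x|^{α} > 0. -/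
/-- The generalized radial stretch mapping `φ(x)ᵢ = xᵢ |x|^{αᵢ}` (with `φ(0) = 0`). -/
noncomputable def radialStretch (n : ℕ) (α : Fin n → ℝ) :
    EuclideanSpace ℝ (Fin n) → EuclideanSpace ℝ (Fin n) := fun x =>
  (WithLp.equiv 2 (Fin n → ℝ)).symm fun i => x i * ‖x‖ ^ α i

/-- Away from the origin, `x ↦ ‖x‖ ^ a` has gradient `a ‖x‖ ^ (a - 2) x`. -/
theorem hasFDerivAt_norm_rpow_of_ne_zero {E : Type*} [NormedAddCommGroup E]
    [InnerProductSpace ℝ E] (a : ℝ) {x : E} (hx : x ≠ 0) :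
    HasFDerivAt (fun y : E => ‖y‖ ^ a) ((a * ‖x‖ ^ (a - 2)) • innerSL ℝ x) x := by
  have hpos : 0 < ‖x‖ := norm_pos_iff.mpr hx
  have h := ((hasStrictFDerivAt_norm_sq x).hasFDerivAt).rpow_const (p := a / 2)
    (Or.inl (pow_ne_zero 2 hpos.ne'))
  have key (r b : ℝ) (hr : 0 ≤ r) : (r ^ 2) ^ b = r ^ (2 * b) := by
    rw [← Real.rpow_natCast, ← Real.rpow_mul hr, Nat.cast_ofNat]
  convert h using 1
  · ext y
    rw [key _ _ (norm_nonneg y), mul_div_cancel₀ a two_ne_zero]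
  · rw [key _ _ hpos.le, show 2 * (a / 2 - 1) = a - 2 by ring]
    ext y
    simp
    ring

/-- The Jacobian matrix of the generalized radial stretch. -/
noncomputable def radialStretchJacobian (n : ℕ) (α : Fin n → ℝ)
    (x : EuclideanSpace ℝ (Fin n)) : Matrix (Fin n) (Fin n) ℝ :=
  Matrix.diagonal (fun i => ‖x‖ ^ α i) *
    (1 + Matrix.replicateCol Unit (fun i => α i * x i / ‖x‖ ^ 2) *
      Matrix.replicateRow Unit (fun j => x j))

theorem det_radialStretchJacobian (n : ℕ) (α : Fin n → ℝ) {x : EuclideanSpace ℝ (Fin n)}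
    (hx : x ≠ 0) :
    (radialStretchJacobian n α x).det =
      (1 + ∑ i, α i * (x i ^ 2 / ‖x‖ ^ 2)) * ‖x‖ ^ (∑ i, α i) := by
  rw [radialStretchJacobian, Matrix.det_mul, Matrix.det_diagonal,
    Matrix.det_one_add_replicateCol_mul_replicateRow,
    Real.rpow_sum_of_pos (norm_pos_iff.mpr hx), mul_comm, dotProduct]
  congr 2
  exact Finset.sum_congr rfl fun i _ => by ring

theorem hasFDerivAt_radialStretch (n : ℕ) (α : Fin n → ℝ) {x : EuclideanSpace ℝ (Fin n)}
    (hx : x ≠ 0) :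
    HasFDerivAt (radialStretch n α)
      (Matrix.toLin (EuclideanSpace.basisFun (Fin n) ℝ).toBasis
        (EuclideanSpace.basisFun (Fin n) ℝ).toBasis
        (radialStretchJacobian n α x)).toContinuousLinearMap x := by
  have hpos : 0 < ‖x‖ := norm_pos_iff.mpr hx
  rw [← hasFDerivWithinAt_univ, hasFDerivWithinAt_euclidean]
  intro i
  have h := ((EuclideanSpace.proj (𝕜 := ℝ) i).hasFDerivAt (x := x)).mul
    (hasFDerivAt_norm_rpow_of_ne_zero (α i) hx)
  refine (h.congr_fderiv ?_).hasFDerivWithinAt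
  ext v
  have hv : (Matrix.toLin (EuclideanSpace.basisFun (Fin n) ℝ).toBasis
      (EuclideanSpace.basisFun (Fin n) ℝ).toBasis (radialStretchJacobian n α x) v) i =
      (radialStretchJacobian n α x).mulVec v i := by
    simp [Matrix.toLin_apply, Finset.sum_apply, Pi.single_apply]
    rfl
  simp only [ContinuousLinearMap.comp_apply, LinearMap.coe_toContinuousLinearMap',
    PiLp.proj_apply, hv]
  have hinner : inner ℝ x v = ∑ j, x j * v j := by
    simp [PiLp.inner_apply, mul_comm]
  rw [radialStretchJacobian, ← Matrix.mulVec_mulVec, Matrix.mulVec_diagonal,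
    Matrix.add_mulVec, Matrix.one_mulVec]
  simp [Matrix.mulVec, Matrix.mul_apply, dotProduct, Real.rpow_sub hpos, hinner, mul_assoc,
    ← Finset.mul_sum]
  ring

/-- Let `n ≥ 2` and `−1 < α₁ ≤ α₂ ≤ ⋯ ≤ αₙ` with sum `α`. For every `x ≠ 0` the Jacobian
determinant of the generalized radial stretch `φ` satisfies
`det Dφ(x) ≥ (1 + α₁)|x|^{α} > 0`. -/
theorem radialStretch_jacobian_det_lower_bound (n : ℕ) (hn : 2 ≤ n) (α : Fin n → ℝ)
    (hmono : Monotone α) (h₁ : -1 < α ⟨0, by omega⟩)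
    (x : EuclideanSpace ℝ (Fin n)) (hx : x ≠ 0) :
    0 < (1 + α ⟨0, by omega⟩) * ‖x‖ ^ (∑ i, α i) ∧
    (1 + α ⟨0, by omega⟩) * ‖x‖ ^ (∑ i, α i) ≤
      LinearMap.det (fderiv ℝ (radialStretch n α) x).toLinearMap := by
  have hpos : 0 < ‖x‖ := norm_pos_iff.mpr hx
  refine ⟨mul_pos (by linarith) (Real.rpow_pos_of_pos hpos _), ?_⟩
  rw [(hasFDerivAt_radialStretch n α hx).fderiv, LinearMap.coe_toContinuousLinearMap,
    LinearMap.det_toLin, det_radialStretchJacobian n α hx]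
  have hsum : ∑ i, x i ^ 2 / ‖x‖ ^ 2 = 1 := by
    rw [← Finset.sum_div, ← EuclideanSpace.real_norm_sq_eq, div_self (pow_ne_zero 2 hpos.ne')]
  gcongr
  calc α ⟨0, by omega⟩ = ∑ i, α ⟨0, by omega⟩ * (x i ^ 2 / ‖x‖ ^ 2) := by
        rw [← Finset.mul_sum, hsum, mul_one]
    _ ≤ ∑ i, α i * (x i ^ 2 / ‖x‖ ^ 2) := by
        gcongr with i
        exact hmono (Fin.mk_le_of_le_val (Nat.zero_le _))
end
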